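/- For all integers n ≥ 1 and i, j, k, the numbers S_n(i,j,k) satisfy S_{n+1}(i,j,k) = S_n(i−1,j−1,k) + 2(j+1)·S_n(i,j+1,k−1) + 2k·S_n(i,j,k) + 2(n−j−k+1)·S_n(i,j,k−1), where S_m(i,j,k) is taken to be 0 whenever any of i, j, k is negative. -/

import Mathlib

open scoped Classical
noncomputable section

/-- The multiset `{1,1,2,2,…,n,n}` as a list. -/
def baseList (n : ℕ) : List ℕ := (List.range n).flatMap (fun i => [i + 1, i + 1])

/-- A word is Stirling if whenever the same value occurs at positions `i < k`,
every entry strictly between them is greater than that value. -/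
def IsStirlingWord (l : List ℕ) : Prop :=
  ∀ i j k : Fin l.length, i < j → j < k → l.get i = l.get k → l.get i < l.get j

/-- The set `Q_n` of Stirling permutations of order `n`:  rearrangements of the
multiset `{1,1,2,2,…,n,n}` in which all entries between the two occurrences of any
value exceed that value. -/
def stirlingPerms (n : ℕ) : Finset (List ℕ) :=
  ((baseList n).permutations.toFinset).filter IsStirlingWord

/-- Number of descents of `σ ∈ Q_n`: indices `i ∈ {1,…,2n}` (here 0-based) with
`σ_i > σ_{i+1}`, with the convention `σ_{2n+1} = 0`. -/
def desList (l : List ℕ) : ℕ :=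
  ((Finset.range l.length).filter (fun i => l.getD (i + 1) 0 < l.getD i 0)).card

/-- The second-order Eulerian polynomial `C_n(x) = ∑_{σ ∈ Q_n} x^{des σ}`. -/
def Cpoly (n : ℕ) : Polynomial ℚ :=
  ∑ σ ∈ stirlingPerms n, Polynomial.X ^ desList σ

/-- A list of cycles is a valid standard cycle form of a Stirling permutation of the
second kind of order `n` if:  the cycles are disjoint and together use each of
`1,1,2,2,…,n,n` exactly once; both copies of any value lie in the same cycle; each
cycle starts with (one of) its smallest entries; the cycles are listed in increasing
order of their smallest (first) entries; and the word of each cycle reduces to a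
Stirling permutation. -/
def IsStirling2 (n : ℕ) (c : List (List ℕ)) : Prop :=
  c.flatten.Perm (baseList n) ∧
  (∀ w ∈ c, w ≠ [] ∧ (∀ v ∈ w, w.count v = 2) ∧ (∀ v ∈ w, w.headI ≤ v) ∧
      IsStirlingWord w) ∧
  c.Chain' (fun w₁ w₂ => w₁.headI < w₂.headI)

/-- The set `Q_n²` of Stirling permutations of the second kind of order `n`,
each recorded as its standard cycle form (a list of cycles). -/
def stirling2 (n : ℕ) : Finset (List (List ℕ)) :=
  ((((baseList n).permutations.toFinset) ×ˢ (Finset.univ : Finset (Composition (2 * n)))).image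
      (fun p => p.1.splitWrtComposition p.2)).filter (IsStirling2 n)

/-- `cyc(σ)`: the number of cycles. -/
def cyc (c : List (List ℕ)) : ℕ := c.length

/-- `cplat(σ)`: the number of cycle plateaus, i.e. entries `c_i` of a cycle
`(c_1,…,c_{2k})` with `c_i = c_{i+1}`, `1 ≤ i < 2k`. -/
def cplat (c : List (List ℕ)) : ℕ :=
  (c.map (fun w => ((Finset.range w.length).filter
    (fun i => i + 1 < w.length ∧ w.getD i 0 = w.getD (i + 1) 0)).card)).sum

/-- `casc(σ)`: the number of cycle ascents, i.e. entries `c_i` of a cycle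
`(c_1,…,c_{2k})` with `c_i < c_{i+1}`, `1 ≤ i < 2k`. -/
def casc (c : List (List ℕ)) : ℕ :=
  (c.map (fun w => ((Finset.range w.length).filter
    (fun i => i + 1 < w.length ∧ w.getD i 0 < w.getD (i + 1) 0)).card)).sum

/-- `cap(σ)`: the number of cycle ascent plateaus, i.e. entries `c_i` of a cycle
`(c_1,…,c_{2k})` with `c_{i-1} < c_i = c_{i+1}`, `2 ≤ i ≤ 2k-1`. -/
def capSt (c : List (List ℕ)) : ℕ :=
  (c.map (fun w => ((Finset.range w.length).filter
    (fun i => 0 < i ∧ i + 1 < w.length ∧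
      w.getD (i - 1) 0 < w.getD i 0 ∧ w.getD i 0 = w.getD (i + 1) 0)).card)).sum

/-- `fix(σ)`: the number of fixed points, i.e. values `k` with `(k,k)` a cycle of `σ`. -/
def fixSt (c : List (List ℕ)) : ℕ :=
  ((Finset.range c.length).filter (fun i => ∃ k : ℕ, c.getD i [] = [k, k])).card

/-- `S_n(i,j,k) = #{σ ∈ Q_n² : cyc(σ) = i, fix(σ) = j, cap(σ) = k}`, with integer
arguments so that `S_n(i,j,k) = 0` whenever any of `i,j,k` is negative. -/
def S2 (n : ℕ) (i j k : ℤ) : ℕ :=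
  ((stirling2 n).filter
    (fun σ => (cyc σ : ℤ) = i ∧ (fixSt σ : ℤ) = j ∧ (capSt σ : ℤ) = k)).card

theorem baseList_succ (n : ℕ) : baseList (n + 1) = baseList n ++ [n + 1, n + 1] := by
  simp [baseList, List.range_succ]

theorem length_baseList (n : ℕ) : (baseList n).length = 2 * n := by
  induction n with
  | zero => simp [baseList]
  | succ n ih => rw [baseList_succ]; simp [ih]; ring

theorem le_of_mem_baseList {n x : ℕ} (h : x ∈ baseList n) : x ≤ n := by
  simp only [baseList, List.mem_flatMap, List.mem_range] at h
  obtain ⟨a, ha, h⟩ := h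
  simp at h
  omega

theorem mem_stirling2 (n : ℕ) (c : List (List ℕ)) : c ∈ stirling2 n ↔ IsStirling2 n c := by
  simp only [stirling2, Finset.mem_filter, Finset.mem_image, Finset.mem_product,
    List.mem_toFinset, List.mem_permutations, Finset.mem_univ, and_true, Prod.exists]
  refine ⟨fun h => h.2, fun h => ⟨?_, h⟩⟩
  have hlen : c.flatten.length = 2 * n := by rw [h.1.length_eq, length_baseList]
  rw [← hlen]
  refine ⟨c.flatten, ⟨c.map List.length, ?_, List.length_flatten.symm⟩, h.1,
    List.splitWrtComposition_flatten _ _ rfl⟩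
  intro i hi
  obtain ⟨w, hw, rfl⟩ := List.mem_map.1 hi
  exact List.length_pos_iff.2 (h.2.1 w hw).1

/-- A word is Stirling iff `a < b` for each of its subsequences `a, b, a`. -/
theorem isStirlingWord_iff (w : List ℕ) :
    IsStirlingWord w ↔ ∀ a b, [a, b, a].Sublist w → a < b := by
  constructor
  · intro h a b hs
    obtain ⟨f, hf⟩ := List.sublist_iff_exists_fin_orderEmbedding_get_eq.1 hs
    have h0 := hf ⟨0, by simp⟩
    have h1 := hf ⟨1, by simp⟩
    have h2 := hf ⟨2, by simp⟩
    have := h (f ⟨0, by simp⟩) (f ⟨1, by simp⟩) (f ⟨2, by simp⟩)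
      (f.strictMono (by simp)) (f.strictMono (by simp))
      (by rw [← h0, ← h2]; rfl)
    rw [← h0, ← h1] at this
    simpa using this
  · intro h i j k hij hjk hik
    refine h _ _ (List.sublist_iff_exists_fin_orderEmbedding_get_eq.2
      ⟨OrderEmbedding.ofStrictMono ![i, j, k] ?_, ?_⟩)
    · intro x y hxy
      have hik' := hij.trans hjk
      fin_cases x <;> fin_cases y <;> first | exact hij | exact hjk | exact hik' | simp at hxy
    · intro x
      fin_cases x
      · simp [OrderEmbedding.ofStrictMono]
      · simp [OrderEmbedding.ofStrictMono]
      · simpa [OrderEmbedding.ofStrictMono] using hik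

theorem IsStirlingWord.of_sublist {w w' : List ℕ} (h : IsStirlingWord w') (hs : w.Sublist w') :
    IsStirlingWord w := by
  rw [isStirlingWord_iff] at h ⊢
  exact fun a b hab => h a b (hab.trans hs)

theorem filter_bne_of_notMem {N : ℕ} {l : List ℕ} (hl : N ∉ l) :
    l.filter (fun x => x != N) = l := by
  rw [List.filter_eq_self]
  intro x hx
  simp only [bne_iff_ne]
  rintro rfl
  exact hl hx

/-- Inserting two adjacent copies of a new maximum preserves the Stirling property. -/
theorem IsStirlingWord.insert {N : ℕ} {u v : List ℕ} (h : IsStirlingWord (u ++ v))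
    (hN : ∀ x ∈ u ++ v, x < N) : IsStirlingWord (u ++ N :: N :: v) := by
  rw [isStirlingWord_iff] at h ⊢
  intro a b hab
  have hNu : N ∉ u := fun hm => (hN N (by simp [hm])).false
  have hNv : N ∉ v := fun hm => (hN N (by simp [hm])).false
  have hfilter := hab.filter (fun x => x != N)
  rw [List.filter_append, filter_bne_of_notMem hNu, List.filter_cons_of_neg (a := N) (by simp),
    List.filter_cons_of_neg (a := N) (by simp), filter_bne_of_notMem hNv] at hfilter
  by_cases ha : a = N
  · subst ha
    exfalso
    clear h hfilter hN
    induction u with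
    | nil =>
      simp only [List.nil_append, List.cons_sublist_cons] at hab
      rcases List.sublist_cons_iff.1 hab with h | ⟨r, hr, h⟩
      · exact hNv (h.subset (by simp))
      · simp only [List.cons.injEq] at hr
        exact hNv (h.subset (by simp [← hr.2]))
    | cons c u ih =>
      simp only [List.mem_cons, not_or] at hNu
      rcases List.sublist_cons_iff.1 hab with h | ⟨r, hr, h⟩
      · exact ih h hNu.2
      · simp only [List.cons.injEq] at hr
        exact hNu.1 hr.1
  · have hau : a ∈ u ++ v := by
      have : a ∈ u ++ N :: N :: v := hab.subset (by simp)
      simp only [List.mem_append, List.mem_cons] at this ⊢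
      tauto
    by_cases hb : b = N
    · rw [hb]; exact hN a hau
    · apply h
      rwa [filter_bne_of_notMem] at hfilter
      simp only [List.mem_cons, List.not_mem_nil, not_or]
      exact ⟨Ne.symm ha, Ne.symm hb, Ne.symm ha, not_false⟩

/-- A Stirling word containing its maximum `N` twice contains the factor `N, N`. -/
theorem IsStirlingWord.exists_eq_append {N : ℕ} {w : List ℕ} (h : IsStirlingWord w)
    (hle : ∀ x ∈ w, x ≤ N) (hc : w.count N = 2) :
    ∃ u v, w = u ++ N :: N :: v ∧ N ∉ u ∧ N ∉ v := by
  rw [isStirlingWord_iff] at h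
  obtain ⟨u, s, rfl, hu⟩ := List.eq_append_cons_of_mem (a := N) (xs := w)
    (List.count_pos_iff.1 (by omega))
  have hs : s.count N = 1 := by
    simpa [List.count_eq_zero_of_not_mem hu] using hc
  obtain ⟨t, v, rfl, ht⟩ := List.eq_append_cons_of_mem (a := N) (xs := s)
    (List.count_pos_iff.1 (by omega))
  have hv : N ∉ v := by
    rw [← List.count_eq_zero]
    simpa [List.count_eq_zero_of_not_mem ht] using hs
  cases t with
  | nil => exact ⟨u, v, rfl, hu, hv⟩
  | cons b t =>
    have h1 := h N b (by
      refine List.Sublist.trans ?_ (List.sublist_append_right _ _)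
      simp only [List.cons_append, List.cons_sublist_cons]
      simp)
    have h2 := hle b (by simp)
    omega

/-- The words obtained from a word by inserting `N, N` after one of its entries. -/
def insertions (N : ℕ) : List ℕ → List (List ℕ)
  | [] => []
  | a :: w => (a :: N :: N :: w) :: (insertions N w).map (a :: ·)

/-- The lists of cycles obtained by inserting `N, N` after an entry of a cycle, or by
appending the cycle `(N, N)`. -/
def extensions (N : ℕ) : List (List ℕ) → List (List (List ℕ))
  | [] => [[[N, N]]]
  | w :: c => (insertions N w).map (· :: c) ++ (extensions N c).map (w :: ·)

theorem mem_insertions {N : ℕ} {w w' : List ℕ} :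
    w' ∈ insertions N w ↔ ∃ u v, u ≠ [] ∧ w = u ++ v ∧ w' = u ++ N :: N :: v := by
  induction w generalizing w' with
  | nil =>
    simp only [insertions, List.not_mem_nil, false_iff]
    rintro ⟨u, v, hu, h, -⟩
    exact hu (List.append_eq_nil_iff.1 h.symm).1
  | cons a w ih =>
    simp only [insertions, List.mem_cons, List.mem_map, ih]
    constructor
    · rintro (rfl | ⟨x, ⟨u, v, hu, rfl, rfl⟩, rfl⟩)
      · exact ⟨[a], w, by simp⟩
      · exact ⟨a :: u, v, by simp⟩
    · rintro ⟨u, v, hu, h, rfl⟩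
      cases u with
      | nil => exact absurd rfl hu
      | cons b u =>
        simp only [List.cons_append, List.cons.injEq] at h
        obtain ⟨rfl, rfl⟩ := h
        cases u with
        | nil => left; rfl
        | cons d u => exact Or.inr ⟨_, ⟨d :: u, v, by simp, rfl, rfl⟩, rfl⟩

theorem mem_extensions {N : ℕ} {c c' : List (List ℕ)} :
    c' ∈ extensions N c ↔ c' = c ++ [[N, N]] ∨ ∃ A u v B, u ≠ [] ∧ c = A ++ (u ++ v) :: B ∧
      c' = A ++ (u ++ N :: N :: v) :: B := by
  induction c generalizing c' with
  | nil => simp [extensions]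
  | cons w c ih =>
    simp only [extensions, List.mem_append, List.mem_map, ih, mem_insertions]
    constructor
    · rintro (⟨_, ⟨u, v, hu, rfl, rfl⟩, rfl⟩ | ⟨x, rfl | ⟨A, u, v, B, hu, rfl, rfl⟩, rfl⟩)
      · exact Or.inr ⟨[], u, v, c, hu, rfl, rfl⟩
      · exact Or.inl rfl
      · exact Or.inr ⟨w :: A, u, v, B, hu, rfl, rfl⟩
    · rintro (rfl | ⟨A, u, v, B, hu, h, rfl⟩)
      · exact Or.inr ⟨_, Or.inl rfl, rfl⟩
      · cases A with
        | nil =>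
          simp only [List.nil_append, List.cons.injEq] at h
          obtain ⟨rfl, rfl⟩ := h
          exact Or.inl ⟨_, ⟨u, v, hu, rfl, rfl⟩, rfl⟩
        | cons x A =>
          simp only [List.cons_append, List.cons.injEq] at h
          obtain ⟨rfl, rfl⟩ := h
          exact Or.inr ⟨_, Or.inr ⟨A, u, v, B, hu, rfl, rfl⟩, rfl⟩

theorem nodup_insertions {N : ℕ} {w : List ℕ} (hN : N ∉ w) : (insertions N w).Nodup := by
  induction w with
  | nil => simp [insertions]
  | cons a w ih =>
    simp only [List.mem_cons, not_or] at hN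
    rw [insertions, List.nodup_cons]
    refine ⟨?_, (ih hN.2).map (List.cons_injective)⟩
    simp only [List.mem_map, List.cons.injEq, true_and, exists_eq_right, mem_insertions]
    rintro ⟨u, v, hu, rfl, h⟩
    cases u with
    | nil => exact hu rfl
    | cons b u =>
      simp only [List.cons_append, List.cons.injEq] at h
      exact hN.2 (by simp [h.1])

theorem nodup_extensions {N : ℕ} {c : List (List ℕ)} (hN : ∀ w ∈ c, N ∉ w) :
    (extensions N c).Nodup := by
  induction c with
  | nil => simp [extensions]
  | cons w c ih =>
    simp only [List.mem_cons, forall_eq_or_imp] at hN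
    rw [extensions, List.nodup_append']
    refine ⟨(nodup_insertions hN.1).map fun x y h => (List.cons.inj h).1,
      (ih hN.2).map List.cons_injective, ?_⟩
    intro x hx hy
    obtain ⟨w', hw', rfl⟩ := List.mem_map.1 hx
    obtain ⟨y, -, hy⟩ := List.mem_map.1 hy
    obtain ⟨u, v, -, rfl, rfl⟩ := mem_insertions.1 hw'
    have := congrArg List.length (List.cons.inj hy).1
    simp at this; omega

/-- Deletes all entries `N`, together with the cycles that become empty. -/
def deletion (N : ℕ) (c : List (List ℕ)) : List (List ℕ) :=
  (c.map (List.filter (fun x => x != N))).filter (fun w => w != [])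

theorem deletion_eq_self {N : ℕ} {c : List (List ℕ)} (h : ∀ w ∈ c, w ≠ [] ∧ N ∉ w) :
    deletion N c = c := by
  have : c.map (List.filter (fun x => x != N)) = c := by
    conv_rhs => rw [← List.map_id c]
    exact List.map_congr_left fun w hw => filter_bne_of_notMem (h w hw).2
  rw [deletion, this, List.filter_eq_self]
  intro w hw
  simpa using (h w hw).1

theorem deletion_append (N : ℕ) (c d : List (List ℕ)) :
    deletion N (c ++ d) = deletion N c ++ deletion N d := by
  simp [deletion]

theorem deletion_of_mem_extensions {N : ℕ} {c c' : List (List ℕ)}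
    (h : ∀ w ∈ c, w ≠ [] ∧ N ∉ w) (hc' : c' ∈ extensions N c) : deletion N c' = c := by
  rcases mem_extensions.1 hc' with rfl | ⟨A, u, v, B, hu, rfl, rfl⟩
  · rw [deletion_append, deletion_eq_self h]
    simp [deletion]
  · rw [← deletion_eq_self h]
    simp [deletion]

theorem isStirling2_iff (n : ℕ) (c : List (List ℕ)) :
    IsStirling2 n c ↔ c.flatten.Perm (baseList n) ∧
      (∀ w ∈ c, w ≠ [] ∧ (∀ v ∈ w, w.count v = 2) ∧ (∀ v ∈ w, w.headI ≤ v) ∧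
        IsStirlingWord w) ∧ (c.map List.headI).Pairwise (· < ·) := by
  rw [IsStirling2, List.Chain', ← List.isChain_map (R := (· < ·)) List.headI,
    List.isChain_iff_pairwise]

theorem IsStirling2.le {n : ℕ} {c : List (List ℕ)} (h : IsStirling2 n c) {w : List ℕ}
    (hw : w ∈ c) {x : ℕ} (hx : x ∈ w) : x ≤ n :=
  le_of_mem_baseList (h.1.subset (List.mem_flatten.2 ⟨w, hw, hx⟩))

theorem IsStirling2.notMem {n : ℕ} {c : List (List ℕ)} (h : IsStirling2 n c) {w : List ℕ}
    (hw : w ∈ c) : n + 1 ∉ w :=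
  fun hm => (h.le hw hm).not_gt n.lt_succ_self

theorem isStirlingWord_pair (a : ℕ) : IsStirlingWord [a, a] := by
  rintro ⟨i, hi⟩ ⟨j, hj⟩ ⟨k, hk⟩ hij hjk
  simp only [List.length_cons, List.length_nil, Fin.mk_lt_mk] at hi hj hk hij hjk
  omega

theorem isStirling2_append_pair (n : ℕ) (c : List (List ℕ)) :
    IsStirling2 (n + 1) (c ++ [[n + 1, n + 1]]) ↔ IsStirling2 n c := by
  have key : (c ++ [[n + 1, n + 1]]).flatten.Perm (baseList (n + 1)) ↔
      c.flatten.Perm (baseList n) := by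
    simp [baseList_succ, List.perm_append_right_iff]
  constructor
  · intro h
    rw [isStirling2_iff] at h ⊢
    refine ⟨key.1 h.1, fun w hw => h.2.1 w (by simp [hw]), ?_⟩
    have := h.2.2
    rw [List.map_append, List.pairwise_append] at this
    exact this.1
  · intro h
    have hle := fun w hw x => h.le (w := w) hw (x := x)
    rw [isStirling2_iff] at h ⊢
    refine ⟨key.2 h.1, fun w hw => ?_, ?_⟩
    · rcases List.mem_append.1 hw with hw | hw
      · exact h.2.1 w hw
      · rw [List.mem_singleton.1 hw]
        exact ⟨by simp, by simp, by simp, isStirlingWord_pair _⟩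
    · rw [List.map_append, List.pairwise_append]
      refine ⟨h.2.2, by simp, ?_⟩
      simp only [List.mem_map, List.map_cons, List.map_nil, List.mem_singleton]
      rintro _ ⟨w, hw, rfl⟩ _ rfl
      have hw0 := (h.2.1 w hw).1
      cases w with
      | nil => exact absurd rfl hw0
      | cons a w => exact Nat.lt_succ_of_le (hle _ hw a (by simp))

theorem isStirling2_insert (n : ℕ) (A B : List (List ℕ)) {u v : List ℕ} (hu : u ≠ [])
    (hNu : n + 1 ∉ u) (hNv : n + 1 ∉ v) :
    IsStirling2 (n + 1) (A ++ (u ++ (n + 1) :: (n + 1) :: v) :: B) ↔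
      IsStirling2 n (A ++ (u ++ v) :: B) := by
  have key : (A ++ (u ++ (n + 1) :: (n + 1) :: v) :: B).flatten.Perm (baseList (n + 1)) ↔
      (A ++ (u ++ v) :: B).flatten.Perm (baseList n) := by
    simp only [List.perm_iff_count, baseList_succ, List.flatten_append, List.flatten_cons,
      List.count_append, List.count_cons, List.count_nil]
    refine forall_congr' fun x => ?_
    omega
  obtain ⟨a, u, rfl⟩ := List.exists_cons_of_ne_nil hu
  constructor
  · intro h
    rw [isStirling2_iff] at h ⊢
    refine ⟨key.1 h.1, fun w hw => ?_, by simpa using h.2.2⟩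
    rcases List.mem_append.1 hw with hw | hw
    · exact h.2.1 w (by simp [hw])
    rcases List.mem_cons.1 hw with rfl | hw
    · obtain ⟨-, h2, h3, h4⟩ := h.2.1 (a :: u ++ (n + 1) :: (n + 1) :: v) (by simp)
      refine ⟨by simp, fun x hx => ?_, fun x hx => h3 x ?_, h4.of_sublist ?_⟩
      · have hxN : n + 1 ≠ x := by
          rintro rfl
          exact (List.mem_append.1 hx).elim hNu hNv
        have := h2 x (by simp only [List.mem_append, List.mem_cons] at hx ⊢; tauto)
        simpa [List.count_append, List.count_cons, hxN] using this
      · simp only [List.mem_append, List.mem_cons] at hx ⊢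
        tauto
      · exact List.Sublist.append_left
          ((List.sublist_cons_self _ _).trans (List.sublist_cons_self _ _)) _
    · exact h.2.1 w (by simp [hw])
  · intro h
    have hle := fun x => h.le (w := a :: u ++ v) (by simp) (x := x)
    rw [isStirling2_iff] at h ⊢
    refine ⟨key.2 h.1, fun w hw => ?_, by simpa using h.2.2⟩
    rcases List.mem_append.1 hw with hw | hw
    · exact h.2.1 w (by simp [hw])
    rcases List.mem_cons.1 hw with rfl | hw
    · obtain ⟨-, h2, h3, h4⟩ := h.2.1 (a :: u ++ v) (by simp)
      refine ⟨by simp, fun x hx => ?_, fun x hx => ?_,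
        h4.insert fun x hx => Nat.lt_succ_of_le (hle x hx)⟩
      · by_cases hxN : n + 1 = x
        · subst hxN
          rw [List.count_append, List.count_eq_zero_of_not_mem hNu]
          simp [List.count_eq_zero_of_not_mem hNv]
        · have := h2 x (by
            simp only [List.mem_append, List.mem_cons, Ne.symm hxN, false_or] at hx ⊢; tauto)
          simpa [List.count_append, List.count_cons, hxN] using this
      · by_cases hxN : n + 1 = x
        · rw [← hxN]
          exact (hle a (by simp)).trans n.le_succ
        · exact h3 x (by
            simp only [List.mem_append, List.mem_cons, Ne.symm hxN, false_or] at hx ⊢; tauto)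
    · exact h.2.1 w (by simp [hw])

/-- Removing the largest value from an element of `Q_{n+1}²` gives an element of `Q_n²`. -/
theorem IsStirling2.exists_mem_extensions {n : ℕ} {c' : List (List ℕ)}
    (h : IsStirling2 (n + 1) c') : ∃ c, IsStirling2 n c ∧ c' ∈ extensions (n + 1) c := by
  have hmem : n + 1 ∈ c'.flatten := h.1.symm.subset (by simp [baseList_succ])
  obtain ⟨w, hw, hN⟩ := List.mem_flatten.1 hmem
  obtain ⟨-, h2, h3, h4⟩ := h.2.1 w hw
  obtain ⟨u, v, rfl, hNu, hNv⟩ := h4.exists_eq_append (fun x => h.le hw) (h2 _ hN)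
  obtain ⟨A, B, rfl⟩ := List.append_of_mem hw
  by_cases hu : u = []
  · subst hu
    have hv : v = [] := by
      refine List.eq_nil_iff_forall_not_mem.2 fun x hx => hNv ?_
      have h5 : n + 1 ≤ x := h3 x (by simp [hx])
      have h6 : x ≤ n + 1 := h.le hw (by simp [hx])
      rwa [← le_antisymm h6 h5]
    subst hv
    have hB : B = [] := by
      cases B with
      | nil => rfl
      | cons b B =>
        exfalso
        have hp := ((isStirling2_iff _ _).1 h).2.2
        rw [List.map_append, List.pairwise_append] at hp
        have hlt : n + 1 < b.headI := by simpa using (List.pairwise_cons.1 hp.2.1).1 b.headI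
        have hb := (h.2.1 b (by simp)).1
        cases b with
        | nil => exact hb rfl
        | cons x b => exact (h.le (w := x :: b) (by simp) (x := x) (by simp)).not_gt hlt
    subst hB
    exact ⟨A, (isStirling2_append_pair n A).1 h, mem_extensions.2 (Or.inl rfl)⟩
  · exact ⟨_, (isStirling2_insert n A B hu hNu hNv).1 h,
      mem_extensions.2 (Or.inr ⟨A, u, v, B, hu, rfl, rfl⟩)⟩

theorem IsStirling2.of_mem_extensions {n : ℕ} {c c' : List (List ℕ)}
    (h : IsStirling2 n c) (hc' : c' ∈ extensions (n + 1) c) : IsStirling2 (n + 1) c' := by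
  rcases mem_extensions.1 hc' with rfl | ⟨A, u, v, B, hu, rfl, rfl⟩
  · exact (isStirling2_append_pair n c).2 h
  · have hN : n + 1 ∉ u ++ v := h.notMem (by simp)
    simp only [List.mem_append, not_or] at hN
    exact (isStirling2_insert n A B hu hN.1 hN.2).2 h

theorem sum_stirling2_succ (n : ℕ) (f : List (List ℕ) → ℤ) :
    ∑ c ∈ stirling2 (n + 1), f c =
      ∑ c ∈ stirling2 n, ((extensions (n + 1) c).map f).sum := by
  have hunion : stirling2 (n + 1) =
      (stirling2 n).biUnion fun c => (extensions (n + 1) c).toFinset := by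
    ext c'
    simp only [Finset.mem_biUnion, List.mem_toFinset, mem_stirling2]
    exact ⟨fun h => h.exists_mem_extensions, fun ⟨c, h, hc'⟩ => h.of_mem_extensions hc'⟩
  rw [hunion, Finset.sum_biUnion]
  · refine Finset.sum_congr rfl fun c hc => ?_
    rw [mem_stirling2] at hc
    exact List.sum_toFinset f (nodup_extensions fun w hw => hc.notMem hw)
  · intro c hc d hd hcd
    rw [Finset.mem_coe, mem_stirling2] at hc hd
    rw [Function.onFun, Finset.disjoint_left]
    intro x hx hy
    rw [List.mem_toFinset] at hx hy
    exact hcd ((deletion_of_mem_extensions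
      (fun w hw => ⟨(hc.2.1 w hw).1, hc.notMem hw⟩) hx).symm.trans
        (deletion_of_mem_extensions (fun w hw => ⟨(hd.2.1 w hw).1, hd.notMem hw⟩) hy))

/-- The number of ascent plateaus of a word. -/
def ascentPlateaus : List ℕ → ℕ
  | a :: b :: c :: t => (if a < b ∧ b = c then 1 else 0) + ascentPlateaus (b :: c :: t)
  | _ => 0

theorem card_filter_eq_ascentPlateaus (w : List ℕ) :
    ((Finset.range w.length).filter (fun i => 0 < i ∧ i + 1 < w.length ∧
      w.getD (i - 1) 0 < w.getD i 0 ∧ w.getD i 0 = w.getD (i + 1) 0)).card =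
      ascentPlateaus w := by
  match w with
  | [] => simp [ascentPlateaus]
  | [a] => simp [ascentPlateaus]
  | [a, b] =>
    rw [ascentPlateaus, Finset.card_eq_zero, Finset.filter_eq_empty_iff]
    · intro i hi
      simp
      omega
    · simp
  | a :: b :: c :: t =>
    rw [ascentPlateaus, ← card_filter_eq_ascentPlateaus (b :: c :: t), Finset.card_filter,
      Finset.card_filter, List.length_cons, Finset.sum_range_succ', List.length_cons,
      Finset.sum_range_succ', Finset.sum_range_succ' _ (c :: t).length]
    simp
    ring

theorem capSt_cons (w : List ℕ) (c : List (List ℕ)) :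
    capSt (w :: c) = ascentPlateaus w + capSt c := by
  simp only [capSt, List.map_cons, List.sum_cons, card_filter_eq_ascentPlateaus]

theorem fixSt_cons (w : List ℕ) (c : List (List ℕ)) :
    fixSt (w :: c) = (if ∃ k, w = [k, k] then 1 else 0) + fixSt c := by
  simp only [fixSt, Finset.card_filter, List.length_cons, Finset.sum_range_succ']
  simp [add_comm]

theorem ascentPlateaus_cons_of_le {a b : ℕ} (h : b ≤ a) (t : List ℕ) :
    ascentPlateaus (a :: b :: t) = ascentPlateaus (b :: t) := by
  cases t with
  | nil => simp [ascentPlateaus]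
  | cons c t => simp [ascentPlateaus, h.not_gt]

/-- Inserting `N, N` preserves the number of ascent plateaus at two positions for each
ascent plateau, and increases it by one at the others. -/
theorem sum_insertions {N : ℕ} (w : List ℕ) (hN : ∀ x ∈ w, x < N) (g : ℤ → ℤ) :
    ((insertions N w).map fun w' => g (ascentPlateaus w')).sum =
      2 * ascentPlateaus w * g (ascentPlateaus w) +
        (w.length - 2 * ascentPlateaus w) * g (ascentPlateaus w + 1) := by
  induction w generalizing g with
  | nil => simp [insertions, ascentPlateaus]
  | cons a w ih =>
    have hNa : a < N := hN a (by simp)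
    match w with
    | [] => simp [insertions, ascentPlateaus, hNa]
    | [b] =>
      have hNb : b < N := hN b (by simp)
      simp [insertions, ascentPlateaus, hNa, hNb, hNb.ne]
      ring
    | b :: c :: t =>
      have hNb : b < N := hN b (by simp)
      have hNc : c < N := hN c (by simp)
      have hNab : ascentPlateaus (a :: N :: N :: b :: c :: t) =
          ascentPlateaus (b :: c :: t) + 1 := by
        simp only [ascentPlateaus, hNa, hNb.not_gt, hNb.ne', true_and, and_false, false_and,
          if_true, if_false]
        ring
      by_cases hp : a < b ∧ b = c
      · obtain ⟨hab, rfl⟩ := hp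
        have ih' := ih (fun x hx => hN x (by simp [hx])) (fun z => g (z + 1))
        have hbb := ascentPlateaus_cons_of_le (le_refl b) t
        have h1 : ascentPlateaus (a :: b :: N :: N :: b :: t) =
            ascentPlateaus (b :: b :: t) + 1 := by
          rw [hbb, ← ascentPlateaus_cons_of_le hNb.le t]
          simp [ascentPlateaus, hNb, hNb.ne, add_comm]
        have h2 : ascentPlateaus (b :: N :: N :: b :: t) =
            ascentPlateaus (b :: b :: t) + 1 := by
          rw [hbb, ← ascentPlateaus_cons_of_le hNb.le t]
          simp [ascentPlateaus, hNb, add_comm]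
        have h3 : ascentPlateaus (a :: b :: b :: t) = ascentPlateaus (b :: b :: t) + 1 := by
          simp [ascentPlateaus, hab, add_comm]
        have h4 : ∀ x : List ℕ, ascentPlateaus (a :: b :: b :: x) =
            ascentPlateaus (b :: b :: x) + 1 := by
          intro x
          simp [ascentPlateaus, hab, add_comm]
        simp only [insertions, List.map_cons, List.map_map, List.sum_cons, Function.comp_def,
          h1, h2, h3, h4, hNab, List.length_cons] at ih' ⊢
        push_cast at ih' ⊢
        linarith
      · have ih' := ih (fun x hx => hN x (by simp [hx])) g
        have h1 : ∀ x : List ℕ, ascentPlateaus (a :: b :: c :: x) =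
            ascentPlateaus (b :: c :: x) := by
          intro x
          simp [ascentPlateaus, hp]
        have h2 : ascentPlateaus (a :: b :: N :: N :: c :: t) =
            ascentPlateaus (b :: N :: N :: c :: t) := by
          simp [ascentPlateaus, hNb.ne]
        simp only [insertions, List.map_cons, List.map_map, List.sum_cons, Function.comp_def,
          h1, h2, hNab, List.length_cons] at ih' ⊢
        push_cast at ih' ⊢
        linarith

theorem sum_extensions {N : ℕ} (c : List (List ℕ)) (hN : ∀ w ∈ c, ∀ x ∈ w, x < N)
    (hlen : ∀ w ∈ c, 2 ≤ w.length) (f : ℤ → ℤ → ℤ → ℤ) :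
    ((extensions N c).map fun c' => f (cyc c') (fixSt c') (capSt c')).sum =
      f (cyc c + 1) (fixSt c + 1) (capSt c) +
        2 * fixSt c * f (cyc c) (fixSt c - 1) (capSt c + 1) +
        2 * capSt c * f (cyc c) (fixSt c) (capSt c) +
        (c.flatten.length - 2 * fixSt c - 2 * capSt c) *
          f (cyc c) (fixSt c) (capSt c + 1) := by
  induction c generalizing f with
  | nil =>
    have hfix : fixSt [] = 0 := by simp [fixSt]
    have hcap : capSt [] = 0 := by simp [capSt]
    simp [extensions, cyc, fixSt_cons, capSt_cons, ascentPlateaus, hfix, hcap]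
  | cons w c ih =>
    have ih' := ih (fun w hw => hN w (by simp [hw])) (fun w hw => hlen w (by simp [hw]))
      (fun x y z => f (x + 1) (y + (if ∃ k, w = [k, k] then 1 else 0)) (z + ascentPlateaus w))
    have hw := sum_insertions w (hN w (by simp))
      (fun z => f (cyc c + 1) (fixSt c) (z + capSt c))
    have hl := hlen w (by simp)
    have hfix : ∀ w' ∈ insertions N w, ¬ ∃ k, w' = [k, k] := by
      rintro w' hw' ⟨k, rfl⟩
      obtain ⟨u, v, -, rfl, h⟩ := mem_insertions.1 hw'
      have := congrArg List.length h
      simp at this hl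
      omega
    have hw2 : ((insertions N w).map fun w' =>
        f (cyc (w' :: c)) (fixSt (w' :: c)) (capSt (w' :: c))).sum =
        ((insertions N w).map fun w' => f (cyc c + 1) (fixSt c)
          (ascentPlateaus w' + capSt c)).sum := by
      congr 1
      refine List.map_congr_left fun w' hw' => ?_
      rw [fixSt_cons, capSt_cons, if_neg (hfix w' hw')]
      simp [cyc]
    have hw3 : ((extensions N c).map fun c' =>
        f (cyc (w :: c')) (fixSt (w :: c')) (capSt (w :: c'))).sum =
        ((extensions N c).map fun c' => f (cyc c' + 1)
          (fixSt c' + (if ∃ k, w = [k, k] then 1 else 0)) (capSt c' + ascentPlateaus w)).sum := by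
      congr 1
      refine List.map_congr_left fun c' hc' => ?_
      rw [fixSt_cons, capSt_cons]
      simp [cyc, add_comm]
    simp only [extensions, List.map_append, List.map_map, List.sum_append, Function.comp_def,
      hw2, hw3, ih', hw]
    rw [fixSt_cons, capSt_cons]
    have hcyc : (cyc (w :: c) : ℤ) = cyc c + 1 := by simp [cyc]
    rw [hcyc]
    simp only [List.flatten_cons, List.length_append]
    by_cases hk : ∃ k, w = [k, k]
    · obtain ⟨k, rfl⟩ := hk
      simp [ascentPlateaus]
      ring_nf
    · simp only [hk, if_false]
      push_cast
      ring_nf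

/-- For all `n ≥ 1` and all integers `i, j, k`:
`S_{n+1}(i,j,k) = S_n(i-1,j-1,k) + 2(j+1) S_n(i,j+1,k-1) + 2k S_n(i,j,k) + 2(n-j-k+1) S_n(i,j,k-1)`. -/
theorem stmt13 (n : ℕ) (hn : 1 ≤ n) (i j k : ℤ) :
    (S2 (n + 1) i j k : ℤ) =
      S2 n (i - 1) (j - 1) k + 2 * (j + 1) * S2 n i (j + 1) (k - 1) +
        2 * k * S2 n i j k + 2 * ((n : ℤ) - j - k + 1) * S2 n i j (k - 1) := by
  have hS : ∀ (m : ℕ) (i j k : ℤ), (S2 m i j k : ℤ) = ∑ c ∈ stirling2 m,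
      if (cyc c : ℤ) = i ∧ (fixSt c : ℤ) = j ∧ (capSt c : ℤ) = k then 1 else 0 := by
    intro m i j k
    rw [S2, Finset.card_filter]
    push_cast
    rfl
  simp only [hS, Finset.mul_sum, ← Finset.sum_add_distrib]
  rw [sum_stirling2_succ]
  refine Finset.sum_congr rfl fun c hc => ?_
  rw [mem_stirling2] at hc
  rw [sum_extensions c (fun w hw x hx => Nat.lt_succ_of_le (hc.le hw hx))
    (fun w hw => ?_) (fun x y z => if x = i ∧ y = j ∧ z = k then 1 else 0),
    hc.1.length_eq, length_baseList]
  · have e1 : ∀ a b : ℤ, a + 1 = b ↔ a = b - 1 := by intros; omega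
    have e2 : ∀ a b : ℤ, a - 1 = b ↔ a = b + 1 := by intros; omega
    simp only [e1, e2]
    push_cast
    congr 1
    · congr 1
      · congr 1
        split_ifs with h
        · rw [h.2.1]
        · simp
      · split_ifs with h
        · rw [h.2.2]
        · simp
    · split_ifs with h
      · rw [h.2.1, h.2.2]; ring
      · simp
  · obtain ⟨h1, h2, -⟩ := hc.2.1 w hw
    obtain ⟨a, t, rfl⟩ := List.exists_cons_of_ne_nil h1
    rw [← h2 a (by simp)]
    exact List.count_le_length
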